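/- arXiv:2603.29530 — 5 statements merged into one kernel-verified Lean document; each statement's English description precedes it below -/
import Mathlib

section
/- Fix n ≥ 1, claim frequencies λ_1,…,λ_n > 0 with λ_• = Σ_{j=1}^n λ_j, mean claim sizes b_1,…,b_n > 0, and an index i ∈ {1,…,n}. Let a_{i,1},…,a_{i,n} ∈ [0,1] satisfy actuarial fairness for row i, Σ_{j=1}^n λ_j a_{i,j} b_j = λ_i b_i, and the capacity constraint for row i, a_{i,j} b_j ≤ b_i for every j. Let W be a nonnegative integrable random variable on a probability space and let g : ℝ → ℝ be convex such that g(b_i W) is integrable and g(a_{i,j} b_j W) is integrable for every j. Then Σ_{j=1}^n (λ_j/λ_•) E[g(a_{i,j} b_j W)] ≤ (1 − λ_i/λ_•) g(0) + (λ_i/λ_•) E[g(b_i W)]. -/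
open MeasureTheory

/-- Jensen-type bound: scaling a random variable by `t ∈ [0, 1]` is dominated, for convex `g`,
by the mixture of the constant `0` and the unscaled variable. -/
theorem ConvexOn.integral_comp_mul_le {Ω : Type*} [MeasurableSpace Ω] {μ : Measure Ω}
    [IsProbabilityMeasure μ] {g : ℝ → ℝ} (hg : ConvexOn ℝ Set.univ g) {X : Ω → ℝ} {t : ℝ}
    (ht0 : 0 ≤ t) (ht1 : t ≤ 1) (hX : Integrable (fun ω => g (X ω)) μ)
    (htX : Integrable (fun ω => g (t * X ω)) μ) :
    ∫ ω, g (t * X ω) ∂μ ≤ (1 - t) * g 0 + t * ∫ ω, g (X ω) ∂μ := by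
  have hbound : Integrable (fun ω => (1 - t) * g 0 + t * g (X ω)) μ :=
    (integrable_const _).add (hX.const_mul t)
  calc ∫ ω, g (t * X ω) ∂μ ≤ ∫ ω, ((1 - t) * g 0 + t * g (X ω)) ∂μ := by
        refine integral_mono htX hbound fun ω => ?_
        simpa using hg.2 (Set.mem_univ 0) (Set.mem_univ (X ω)) (sub_nonneg.2 ht1) ht0
          (sub_add_cancel 1 t)
    _ = (1 - t) * g 0 + t * ∫ ω, g (X ω) ∂μ := by
        rw [integral_add (integrable_const _) (hX.const_mul t), integral_const_mul t]
        simp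

/-- Key convex-order comparison: under actuarial fairness and the capacity constraint
for row `i`, the expected convex transform of the pooled payment is dominated by the
corresponding mixture of the stand-alone payment. -/
theorem pooled_convex_comparison
    (n : ℕ) (hn : 1 ≤ n)
    (lam b : Fin n → ℝ) (hlam : ∀ j, 0 < lam j) (hb : ∀ j, 0 < b j)
    (i : Fin n) (a : Fin n → ℝ) (ha : ∀ j, a j ∈ Set.Icc (0 : ℝ) 1)
    (hfair : ∑ j, lam j * a j * b j = lam i * b i)
    (hcap : ∀ j, a j * b j ≤ b i)
    {Ω : Type*} [MeasurableSpace Ω] (μ : Measure Ω) [IsProbabilityMeasure μ]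
    (W : Ω → ℝ) (hWnn : ∀ ω, 0 ≤ W ω) (hWint : Integrable W μ)
    (g : ℝ → ℝ) (hg : ConvexOn ℝ Set.univ g)
    (hgint : Integrable (fun ω => g (b i * W ω)) μ)
    (hgintj : ∀ j, Integrable (fun ω => g (a j * b j * W ω)) μ) :
    ∑ j, (lam j / (∑ k, lam k)) * ∫ ω, g (a j * b j * W ω) ∂μ ≤
      (1 - lam i / (∑ k, lam k)) * g 0
        + (lam i / (∑ k, lam k)) * ∫ ω, g (b i * W ω) ∂μ := by
  have hbi := (hb i).ne'
  have hL : 0 < ∑ k, lam k := Finset.sum_pos (fun j _ => hlam j) ⟨i, Finset.mem_univ i⟩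
  have hscale (j : Fin n) (ω : Ω) : a j * b j * W ω = a j * b j / b i * (b i * W ω) := by
    field_simp
  have hterm (j : Fin n) : ∫ ω, g (a j * b j * W ω) ∂μ ≤
      (1 - a j * b j / b i) * g 0 + a j * b j / b i * ∫ ω, g (b i * W ω) ∂μ := by
    have hint := hgintj j
    simp only [hscale j] at hint ⊢
    exact hg.integral_comp_mul_le (div_nonneg (mul_nonneg (ha j).1 (hb j).le) (hb i).le)
      ((div_le_one (hb i)).2 (hcap j)) hgint hint
  have hweights : ∑ j, lam j / (∑ k, lam k) = 1 := by
    rw [← Finset.sum_div, div_self hL.ne']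
  have hmean : ∑ j, lam j / (∑ k, lam k) * (a j * b j / b i) = lam i / ∑ k, lam k := by
    calc ∑ j, lam j / (∑ k, lam k) * (a j * b j / b i)
        = (∑ j, lam j * a j * b j) / ((∑ k, lam k) * b i) := by
          rw [Finset.sum_div]
          exact Finset.sum_congr rfl fun j _ => by rw [div_mul_div_comm, mul_assoc]
      _ = lam i / ∑ k, lam k := by rw [hfair, mul_div_mul_right _ _ hbi]
  refine (Finset.sum_le_sum fun j _ =>
    mul_le_mul_of_nonneg_left (hterm j) (div_pos (hlam j) hL).le).trans_eq ?_
  simp only [mul_add, ← mul_assoc, mul_sub, mul_one, Finset.sum_add_distrib, ← Finset.sum_mul,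
    Finset.sum_sub_distrib]
  simp only [← mul_assoc, mul_div_assoc] at hmean ⊢
  rw [hmean, hweights]
end

section
/- Fix n ≥ 1, claim frequencies λ_1,…,λ_n > 0, mean claim sizes b_1,…,b_n > 0, and an index i. Let a_{i,1},…,a_{i,n} ∈ [0,1] satisfy Σ_{j=1}^n λ_j a_{i,j} b_j = λ_i b_i and a_{i,j} b_j ≤ b_i for every j. Let W be a nonnegative integrable random variable on a probability space. Then for every t ≥ 0, Σ_{j=1}^n λ_j E[max(a_{i,j} b_j W − t, 0)] ≤ λ_i E[max(b_i W − t, 0)]. -/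
open MeasureTheory

theorem max_mul_sub_zero_le_div_mul {c B w t : ℝ} (hc : 0 ≤ c) (hB : 0 < B) (hcB : c ≤ B)
    (ht : 0 ≤ t) : max (c * w - t) 0 ≤ c / B * max (B * w - t) 0 := by
  have hr : 0 ≤ c / B := div_nonneg hc hB.le
  refine max_le ?_ (mul_nonneg hr (le_max_right _ _))
  calc c * w - t ≤ c * w - c / B * t :=
        sub_le_sub_left (mul_le_of_le_one_left ht ((div_le_one hB).2 hcB)) _
    _ = c / B * (B * w - t) := by field_simp
    _ ≤ c / B * max (B * w - t) 0 := mul_le_mul_of_nonneg_left (le_max_left _ _) hr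

theorem integrable_max_mul_sub_zero {Ω : Type*} [MeasurableSpace Ω] {μ : Measure Ω}
    [IsFiniteMeasure μ] {W : Ω → ℝ} (hW : Integrable W μ) (c t : ℝ) :
    Integrable (fun ω => max (c * W ω - t) 0) μ :=
  ((hW.const_mul c).sub (integrable_const t)).pos_part

theorem integral_max_mul_sub_zero_le {Ω : Type*} [MeasurableSpace Ω] {μ : Measure Ω}
    [IsFiniteMeasure μ] {W : Ω → ℝ} (hW : Integrable W μ) {c B t : ℝ} (hc : 0 ≤ c)
    (hB : 0 < B) (hcB : c ≤ B) (ht : 0 ≤ t) :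
    ∫ ω, max (c * W ω - t) 0 ∂μ ≤ c / B * ∫ ω, max (B * W ω - t) 0 ∂μ := by
  rw [← integral_const_mul]
  exact integral_mono (integrable_max_mul_sub_zero hW c t)
    ((integrable_max_mul_sub_zero hW B t).const_mul _)
    fun ω => max_mul_sub_zero_le_div_mul hc hB hcB ht

/-- Stop-loss (expected excess) form of the convex-order comparison: under actuarial
fairness and the capacity constraint for row `i`, the weighted expected excesses of the
pooled payments are dominated by that of the stand-alone payment. -/
theorem pooled_stop_loss_comparison
    (n : ℕ) (hn : 1 ≤ n)
    (lam b : Fin n → ℝ) (hlam : ∀ j, 0 < lam j) (hb : ∀ j, 0 < b j)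
    (i : Fin n) (a : Fin n → ℝ) (ha : ∀ j, a j ∈ Set.Icc (0 : ℝ) 1)
    (hfair : ∑ j, lam j * a j * b j = lam i * b i)
    (hcap : ∀ j, a j * b j ≤ b i)
    {Ω : Type*} [MeasurableSpace Ω] (μ : Measure Ω) [IsProbabilityMeasure μ]
    (W : Ω → ℝ) (hWnn : ∀ ω, 0 ≤ W ω) (hWint : Integrable W μ)
    (t : ℝ) (ht : 0 ≤ t) :
    ∑ j, lam j * ∫ ω, max (a j * b j * W ω - t) 0 ∂μ ≤
      lam i * ∫ ω, max (b i * W ω - t) 0 ∂μ := by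
  have hB := hb i
  set I := ∫ ω, max (b i * W ω - t) 0 ∂μ
  calc ∑ j, lam j * ∫ ω, max (a j * b j * W ω - t) 0 ∂μ
      ≤ ∑ j, lam j * (a j * b j / b i * I) :=
        Finset.sum_le_sum fun j _ => mul_le_mul_of_nonneg_left
          (integral_max_mul_sub_zero_le hWint (mul_nonneg (ha j).1 (hb j).le) hB (hcap j) ht)
          (hlam j).le
    _ = (∑ j, lam j * a j * b j) * (I / b i) := by
        rw [Finset.sum_mul]
        exact Finset.sum_congr rfl fun j _ => by ring
    _ = lam i * I := by
        rw [hfair]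
        field_simp
end

section
/- Let n ≥ 2 and let Y_1,…,Y_n be nonnegative integrable random variables on a probability space with means b_i = E[Y_i] ∈ (0,∞). Suppose that for every matrix (a_{i,j}) with a_{i,j} ∈ [0,1], Σ_{i=1}^n a_{i,j} = 1 for all j (full allocation) and Σ_{j=1}^n a_{i,j} b_j = b_i for all i (actuarial fairness under homogeneous frequencies), and for every i, the convex-order comparison holds: for every convex g : ℝ → ℝ such that all expectations below exist, (1/n) Σ_{j=1}^n E[g(a_{i,j} Y_j)] ≤ (1 − 1/n) g(0) + (1/n) E[g(Y_i)]. Then for every pair i ≠ j with b_i ≤ b_j and every convex g : ℝ → ℝ such that g((b_i/b_j) Y_j) and g(Y_i) are integrable, E[g((b_i/b_j) Y_j)] ≤ E[g(Y_i)]; that is, Y_j/b_j precedes Y_i/b_i in the convex order. -/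
open MeasureTheory

/-- If, for every admissible sharing matrix (full allocation and actuarial fairness
under homogeneous frequencies), each pooled payment `Z_i = a i J * Y J` (with `J`
uniform) is dominated in the convex order by the stand-alone benchmark
`Y'_i = B_i Y_i` (with `B_i` Bernoulli(1/n)), then the normalized severities are
monotonically ordered in the convex order: `b i ≤ b j` implies
`Y j / b j ⪯_cx Y i / b i`. -/
theorem convex_order_necessity
    (n : ℕ) (hn : 2 ≤ n)
    {Ω : Type*} [MeasurableSpace Ω] (μ : Measure Ω) [IsProbabilityMeasure μ]
    (Y : Fin n → Ω → ℝ) (hYnn : ∀ i ω, 0 ≤ Y i ω) (hYint : ∀ i, Integrable (Y i) μ)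
    (b : Fin n → ℝ) (hb : ∀ i, 0 < b i) (hbY : ∀ i, b i = ∫ ω, Y i ω ∂μ)
    (hcx : ∀ a : Fin n → Fin n → ℝ,
      (∀ i j, a i j ∈ Set.Icc (0 : ℝ) 1) →
      (∀ j, ∑ i, a i j = 1) →
      (∀ i, ∑ j, a i j * b j = b i) →
      ∀ i, ∀ g : ℝ → ℝ, ConvexOn ℝ Set.univ g →
        (∀ j, Integrable (fun ω => g (a i j * Y j ω)) μ) →
        Integrable (fun ω => g (Y i ω)) μ →
        (1 / (n : ℝ)) * ∑ j, ∫ ω, g (a i j * Y j ω) ∂μ ≤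
          (1 - 1 / (n : ℝ)) * g 0 + (1 / (n : ℝ)) * ∫ ω, g (Y i ω) ∂μ) :
    ∀ i j : Fin n, i ≠ j → b i ≤ b j →
      ∀ g : ℝ → ℝ, ConvexOn ℝ Set.univ g →
        Integrable (fun ω => g ((b i / b j) * Y j ω)) μ →
        Integrable (fun ω => g (Y i ω)) μ →
        ∫ ω, g ((b i / b j) * Y j ω) ∂μ ≤ ∫ ω, g (Y i ω) ∂μ := by
  intro i j hij hbij g hg hgj hgi
  have hbj := hb j
  have hr0 : 0 ≤ b i / b j := (div_pos (hb i) hbj).le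
  have hr1 : b i / b j ≤ 1 := (div_le_one hbj).2 hbij
  have hrb : b i / b j * b j = b i := div_mul_cancel₀ _ hbj.ne'
  set r := b i / b j with hr
  let a : Fin n → Fin n → ℝ := fun k l =>
    (if k = l then 1 else 0) +
      ((if k = j then 1 else 0) - (if k = i then 1 else 0)) *
        ((if l = i then 1 else 0) - r * (if l = j then 1 else 0))
  have hai : ∀ l, a i l = if l = j then r else 0 := by
    intro l
    simp only [a]
    grind
  have hterm : ∀ l, (fun ω => g (a i l * Y l ω)) =
      if l = j then (fun ω => g (r * Y j ω)) else fun _ => g 0 := by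
    intro l
    rw [hai]
    split_ifs with h
    · rw [h]
    · simp
  have key := hcx a ?_ ?_ ?_ i g hg ?_ hgi
  · have hsum : ∑ l, ∫ ω, g (a i l * Y l ω) ∂μ =
        (∫ ω, g (r * Y j ω) ∂μ) + ((n : ℝ) - 1) * g 0 := by
      have hint : ∀ l, ∫ ω, g (a i l * Y l ω) ∂μ =
          g 0 + if l = j then (∫ ω, g (r * Y j ω) ∂μ) - g 0 else 0 := by
        intro l
        rw [hterm]
        split_ifs <;> simp
      simp only [hint, Finset.sum_add_distrib, Finset.sum_ite_eq', Finset.mem_univ, if_true,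
        Finset.sum_const, Finset.card_univ, Fintype.card_fin, nsmul_eq_mul]
      ring
    rw [hsum] at key
    have hnpos : (0 : ℝ) < n := by exact_mod_cast (by omega : 0 < n)
    field_simp at key
    linarith
  · intro k l
    simp only [a, Set.mem_Icc]
    clear_value r
    clear * - hij hr0 hr1
    split_ifs <;> subst_vars <;> first | contradiction | (constructor <;> linarith)
  · intro l
    simp [a, Finset.sum_add_distrib, ← Finset.sum_mul]
  · intro k
    simp [a, add_mul, sub_mul, mul_sub, Finset.sum_add_distrib, hrb]
  · intro l
    rw [hterm]
    split_ifs
    · exact hgj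
    · exact integrable_const _
end

section
/- For every convex function g : ℝ → ℝ, (1/3)·g(0) + (1/6)·(g(50) + g(100) + g(450/11) + g(1200/11)) ≤ (2/3)·g(0) + (1/6)·(g(100) + g(200)). -/
/-- A convex function on `ℝ` lies below its chord over `[0, c]`. -/
theorem ConvexOn.le_chord_zero {g : ℝ → ℝ} (hg : ConvexOn ℝ Set.univ g) {c t : ℝ}
    (ht₀ : 0 ≤ t) (ht₁ : t ≤ 1) : g (t * c) ≤ (1 - t) * g 0 + t * g c := by
  simpa using hg.2 (Set.mem_univ 0) (Set.mem_univ c) (sub_nonneg.2 ht₁) ht₀ (sub_add_cancel 1 t)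

/-- Convex-order domination `Z_1 ⪯_cx Y'_1` in the paper's two-participant
counterexample with random stand-alone losses. -/
theorem counterexample_random_Z1_cx
    (g : ℝ → ℝ) (hg : ConvexOn ℝ Set.univ g) :
    (1 / 3 : ℝ) * g 0 + (1 / 6 : ℝ) * (g 50 + g 100 + g (450 / 11) + g (1200 / 11)) ≤
      (2 / 3 : ℝ) * g 0 + (1 / 6 : ℝ) * (g 100 + g 200) := by
  have h₁ := hg.le_chord_zero (c := 200) (t := 1 / 4) (by norm_num) (by norm_num)
  have h₂ := hg.le_chord_zero (c := 200) (t := 9 / 44) (by norm_num) (by norm_num)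
  have h₃ := hg.le_chord_zero (c := 200) (t := 6 / 11) (by norm_num) (by norm_num)
  rw [show (1 / 4 : ℝ) * 200 = 50 by norm_num] at h₁
  rw [show (9 / 44 : ℝ) * 200 = 450 / 11 by norm_num] at h₂
  rw [show (6 / 11 : ℝ) * 200 = 1200 / 11 by norm_num] at h₃
  linarith
end

section
/- For every convex function g : ℝ → ℝ, (1/3)·g(0) + (1/6)·(g(50) + g(100) + g(1200/11) + g(3200/11)) ≤ (2/3)·g(0) + (1/6)·(g(150) + g(400)). -/
/-- A convex function on the line lies below its chord from `0` to `x`. -/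
theorem ConvexOn.map_mul_le_chord_zero {g : ℝ → ℝ} (hg : ConvexOn ℝ Set.univ g) {t : ℝ}
    (ht₀ : 0 ≤ t) (ht₁ : t ≤ 1) (x : ℝ) : g (t * x) ≤ (1 - t) * g 0 + t * g x := by
  simpa using hg.2 (Set.mem_univ 0) (Set.mem_univ x) (sub_nonneg.2 ht₁) ht₀ (sub_add_cancel 1 t)

/-- Convex-order domination `Z_2 ⪯_cx Y'_2` in the paper's two-participant
counterexample with random stand-alone losses. -/
theorem counterexample_random_Z2_cx
    (g : ℝ → ℝ) (hg : ConvexOn ℝ Set.univ g) :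
    (1 / 3 : ℝ) * g 0 + (1 / 6 : ℝ) * (g 50 + g 100 + g (1200 / 11) + g (3200 / 11)) ≤
      (2 / 3 : ℝ) * g 0 + (1 / 6 : ℝ) * (g 150 + g 400) := by
  have h₁ := hg.map_mul_le_chord_zero (t := 1 / 3) (by norm_num) (by norm_num) 150
  have h₂ := hg.map_mul_le_chord_zero (t := 2 / 3) (by norm_num) (by norm_num) 150
  have h₃ := hg.map_mul_le_chord_zero (t := 3 / 11) (by norm_num) (by norm_num) 400
  have h₄ := hg.map_mul_le_chord_zero (t := 8 / 11) (by norm_num) (by norm_num) 400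
  norm_num at h₁ h₂ h₃ h₄
  linarith
end
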